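/- Let ν be a probability measure on a finite set Ω, let g : Ω → ℝ be not identically zero, let ρ > 0, and let 0 ≤ T ≤ 1/(2ρ). Then ∫₀^T ‖g‖²_{1+e^{−2ρt}} dt ≤ 4‖g‖₂² / (ρ·(1 + log(‖g‖₂/‖g‖₁))). -/

import Mathlib

open scoped BigOperators

noncomputable section

/-- `‖g‖_p = (E_ν |g|^p)^{1/p}` for a discrete measure `ν` on a finite set `Ω`. -/
def pnorm {Ω : Type} [Fintype Ω] (ν : Ω → ℝ) (p : ℝ) (g : Ω → ℝ) : ℝ :=
  (∑ x, ν x * |g x| ^ p) ^ (1 / p)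

open Real in
/-- Hölder interpolation of the `(1 + s)`-th absolute moment between the first and the second. -/
lemma sum_mul_abs_rpow_le {Ω : Type} [Fintype Ω] (ν : Ω → ℝ) (hν0 : ∀ x, 0 ≤ ν x) (g : Ω → ℝ)
    {s : ℝ} (hs0 : 0 ≤ s) (hs1 : s ≤ 1) (hA : 0 < ∑ x, ν x * |g x|)
    (hB : 0 < ∑ x, ν x * |g x| ^ 2) :
    ∑ x, ν x * |g x| ^ (1 + s) ≤
      (∑ x, ν x * |g x|) ^ (1 - s) * (∑ x, ν x * |g x| ^ 2) ^ s := by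
  set A := ∑ x, ν x * |g x| with hAdef
  set B := ∑ x, ν x * |g x| ^ 2 with hBdef
  have key (x : Ω) : |g x| ^ (1 + s) ≤
      ((1 - s) * (|g x| / A) + s * (|g x| ^ 2 / B)) * (A ^ (1 - s) * B ^ s) := by
    have h := geom_mean_le_arith_mean2_weighted (sub_nonneg.2 hs1) hs0
      (div_nonneg (abs_nonneg (g x)) hA.le) (div_nonneg (sq_nonneg |g x|) hB.le) (by ring)
    rw [div_rpow (abs_nonneg _) hA.le, div_rpow (sq_nonneg _) hB.le, div_mul_div_comm,
      div_le_iff₀ (by positivity)] at h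
    refine le_of_eq_of_le ?_ h
    rw [← rpow_natCast, ← rpow_mul (abs_nonneg _), ← rpow_add_of_nonneg (abs_nonneg _)
      (sub_nonneg.2 hs1) (by positivity)]
    congr 1
    push_cast
    ring
  calc ∑ x, ν x * |g x| ^ (1 + s)
      ≤ ∑ x, ν x * (((1 - s) * (|g x| / A) + s * (|g x| ^ 2 / B)) * (A ^ (1 - s) * B ^ s)) :=
        Finset.sum_le_sum fun x _ => mul_le_mul_of_nonneg_left (key x) (hν0 x)
    _ = ((1 - s) / A * A + s / B * B) * (A ^ (1 - s) * B ^ s) := by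
        nth_rewrite 4 [hBdef]
        nth_rewrite 3 [hAdef]
        rw [Finset.mul_sum, Finset.mul_sum, ← Finset.sum_add_distrib, Finset.sum_mul]
        refine Finset.sum_congr rfl fun x _ => ?_
        ring
    _ = A ^ (1 - s) * B ^ s := by
        rw [div_mul_cancel₀ _ hA.ne', div_mul_cancel₀ _ hB.ne']
        ring

lemma sq_sum_mul_abs_le {Ω : Type} [Fintype Ω] (ν : Ω → ℝ) (hν0 : ∀ x, 0 ≤ ν x)
    (hν1 : ∑ x, ν x = 1) (g : Ω → ℝ) :
    (∑ x, ν x * |g x|) ^ 2 ≤ ∑ x, ν x * |g x| ^ 2 :=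
  Real.pow_arith_mean_le_arith_mean_pow Finset.univ ν (fun x => |g x|) (fun x _ => hν0 x) hν1
    (fun x _ => abs_nonneg (g x)) 2

lemma pnorm_one {Ω : Type} [Fintype Ω] (ν g : Ω → ℝ) : pnorm ν 1 g = ∑ x, ν x * |g x| := by
  simp [pnorm]

lemma pnorm_two {Ω : Type} [Fintype Ω] (ν g : Ω → ℝ) :
    pnorm ν 2 g = √(∑ x, ν x * |g x| ^ 2) := by
  simp [pnorm, Real.sqrt_eq_rpow]

lemma continuous_pnorm {Ω : Type} [Fintype Ω] (ν g : Ω → ℝ) {p : ℝ → ℝ}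
    (hp : Continuous p) (hp0 : ∀ t, 0 < p t) : Continuous fun t => pnorm ν (p t) g := by
  unfold pnorm
  refine Continuous.rpow ?_ (continuous_const.div hp fun t => (hp0 t).ne')
    fun t => Or.inr (one_div_pos.2 (hp0 t))
  exact continuous_finsetSum _ fun x _ =>
    continuous_const.mul (continuous_const.rpow hp fun t => Or.inr (hp0 t))

open Real in
lemma pnorm_sq_le_mul_exp {Ω : Type} [Fintype Ω] (ν : Ω → ℝ) (hν0 : ∀ x, 0 ≤ ν x)
    (g : Ω → ℝ) {s : ℝ} (hs0 : 0 ≤ s) (hs1 : s ≤ 1) (h1 : 0 < pnorm ν 1 g)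
    (h2 : 0 < pnorm ν 2 g) :
    pnorm ν (1 + s) g ^ 2 ≤ pnorm ν 2 g ^ 2 *
      exp (-(2 * (1 - s) / (1 + s) * log (pnorm ν 2 g / pnorm ν 1 g))) := by
  rw [log_div h2.ne' h1.ne']
  rw [pnorm_one] at *
  rw [pnorm_two] at *
  have hB := sqrt_pos.1 h2
  have hle := sum_mul_abs_rpow_le ν hν0 g hs0 hs1 h1 hB
  have hS : 0 ≤ ∑ x, ν x * |g x| ^ (1 + s) :=
    Finset.sum_nonneg fun x _ => mul_nonneg (hν0 x) (rpow_nonneg (abs_nonneg _) _)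
  rw [sq_sqrt hB.le, log_sqrt hB.le]
  set A := ∑ x, ν x * |g x|
  set B := ∑ x, ν x * |g x| ^ 2
  calc pnorm ν (1 + s) g ^ 2
      = (∑ x, ν x * |g x| ^ (1 + s)) ^ (1 / (1 + s) * (2 : ℕ)) := by
        rw [rpow_mul hS, rpow_natCast]
        rfl
    _ ≤ (A ^ (1 - s) * B ^ s) ^ (1 / (1 + s) * (2 : ℕ)) :=
        rpow_le_rpow hS hle (by positivity)
    _ = exp (log B) * exp (-(2 * (1 - s) / (1 + s) * (log B / 2 - log A))) := by
        rw [rpow_def_of_pos (by positivity), log_mul (by positivity) (by positivity),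
          log_rpow h1, log_rpow hB, ← exp_add]
        congr 1
        have : 1 + s ≠ 0 := by positivity
        push_cast
        field_simp
        ring
    _ = _ := by rw [exp_log hB]

/-- Elementary lower bound for `2 * tanh u`, written in terms of `exp (-(2 * u))`. -/
lemma le_two_mul_one_sub_exp_div {u : ℝ} (hu0 : 0 ≤ u) (hu1 : u ≤ 1 / 2) :
    u ≤ 2 * (1 - Real.exp (-(2 * u))) / (1 + Real.exp (-(2 * u))) := by
  have hpos := Real.exp_pos (-(2 * u))
  have h1 : Real.exp (-(2 * u)) ≤ 1 := Real.exp_le_one_iff.2 (by linarith)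
  have h2 : Real.exp (-(2 * u)) * (1 + 2 * u) ≤ 1 := by
    have h := mul_le_mul_of_nonneg_left (Real.add_one_le_exp (2 * u)) hpos.le
    rw [← Real.exp_add, neg_add_cancel, Real.exp_zero] at h
    linarith
  rw [le_div_iff₀ (by linarith)]
  nlinarith

lemma integral_exp_neg_mul_le {c : ℝ} (hc : 0 < c) (T : ℝ) :
    ∫ t in (0:ℝ)..T, Real.exp (-(c * t)) ≤ 1 / c := by
  have hd (t : ℝ) : HasDerivAt (fun t => -Real.exp (-(c * t)) / c) (Real.exp (-(c * t))) t := by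
    have h := (((hasDerivAt_id t).const_mul c).neg.exp.neg).div_const c
    refine h.congr_deriv ?_
    simp only [id, Pi.neg_apply]
    field_simp
  rw [intervalIntegral.integral_eq_sub_of_hasDerivAt (fun t _ => hd t)
    (Continuous.intervalIntegrable (by fun_prop) _ _)]
  simp only [mul_zero, neg_zero, Real.exp_zero, ← sub_div]
  gcongr
  linarith [Real.exp_pos (-(c * T))]

/-- **Integral bound for interpolated norms** (part of the proof of Theorem 3.6).
Let `ν` be a probability measure on a finite set `Ω`, `g : Ω → ℝ` not identically zero,
`ρ > 0` and `0 ≤ T ≤ 1/(2ρ)`. Then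
`∫₀^T ‖g‖²_{1+e^{-2ρt}} dt ≤ 4‖g‖₂² / (ρ(1 + log(‖g‖₂/‖g‖₁)))`. -/
theorem integral_pnorm_interp_le {Ω : Type} [Fintype Ω] (ν : Ω → ℝ)
    (hν0 : ∀ x, 0 ≤ ν x) (hν1 : ∑ x, ν x = 1)
    (g : Ω → ℝ) (hg : g ≠ 0) (ρ : ℝ) (hρ : 0 < ρ)
    (T : ℝ) (hT0 : 0 ≤ T) (hT : T ≤ 1 / (2 * ρ)) :
    ∫ t in (0:ℝ)..T, (pnorm ν (1 + Real.exp (-(2 * ρ * t))) g) ^ 2 ≤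
      4 * (pnorm ν 2 g) ^ 2 / (ρ * (1 + Real.log (pnorm ν 2 g / pnorm ν 1 g))) := by
  have hcont : Continuous fun t : ℝ => pnorm ν (1 + Real.exp (-(2 * ρ * t))) g :=
    continuous_pnorm ν g (by fun_prop) fun t => by positivity
  have hA0 : 0 ≤ ∑ x, ν x * |g x| :=
    Finset.sum_nonneg fun x _ => mul_nonneg (hν0 x) (abs_nonneg _)
  rcases hA0.eq_or_lt with hA | hA
  · have hz : ∀ x, ν x = 0 ∨ g x = 0 := by
      intro x
      simpa using (Finset.sum_eq_zero_iff_of_nonneg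
        fun x _ => mul_nonneg (hν0 x) (abs_nonneg (g x))).1 hA.symm x (Finset.mem_univ x)
    have hp : ∀ p : ℝ, 0 < p → pnorm ν p g = 0 := by
      intro p hp
      have hsum : ∑ x, ν x * |g x| ^ p = 0 := Finset.sum_eq_zero fun x _ => by
        rcases hz x with h | h <;> simp [h, Real.zero_rpow hp.ne']
      rw [pnorm, hsum, Real.zero_rpow (one_div_pos.2 hp).ne']
    have hp' (t : ℝ) : pnorm ν (1 + Real.exp (-(2 * ρ * t))) g = 0 := hp _ (by positivity)
    simp [hp', hp 2 two_pos]
  have hle : pnorm ν 1 g ≤ pnorm ν 2 g := by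
    rw [pnorm_one, pnorm_two]
    exact Real.le_sqrt_of_sq_le (sq_sum_mul_abs_le ν hν0 hν1 g)
  have h1 : 0 < pnorm ν 1 g := by rwa [pnorm_one]
  have h2 := h1.trans_le hle
  have hL : 0 ≤ Real.log (pnorm ν 2 g / pnorm ν 1 g) :=
    Real.log_nonneg ((one_le_div h1).2 hle)
  have hbound : ∀ t ∈ Set.Icc 0 T, pnorm ν (1 + Real.exp (-(2 * ρ * t))) g ^ 2 ≤
      4 * pnorm ν 2 g ^ 2 *
        Real.exp (-(ρ * (1 + Real.log (pnorm ν 2 g / pnorm ν 1 g)) * t)) := by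
    rintro t ⟨ht0, htT⟩
    have hu0 : 0 ≤ ρ * t := by positivity
    have hu1 : ρ * t ≤ 1 / 2 := by
      have h := mul_le_mul_of_nonneg_left (htT.trans hT) hρ.le
      rwa [show ρ * (1 / (2 * ρ)) = 1 / 2 by field_simp] at h
    have hu := le_two_mul_one_sub_exp_div hu0 hu1
    rw [← mul_assoc] at hu
    refine (pnorm_sq_le_mul_exp ν hν0 g (Real.exp_pos _).le
      (Real.exp_le_one_iff.2 (by nlinarith)) h1 h2).trans ?_
    have he : Real.exp (ρ * t) ≤ 4 := by
      have := Real.exp_le_exp.2 (hu1.trans (by norm_num : (1 / 2 : ℝ) ≤ 1))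
      linarith [Real.exp_one_lt_d9]
    calc _ ≤ pnorm ν 2 g ^ 2 *
          Real.exp (-(ρ * t * Real.log (pnorm ν 2 g / pnorm ν 1 g))) := by gcongr
      _ = Real.exp (ρ * t) * pnorm ν 2 g ^ 2 *
          Real.exp (-(ρ * (1 + Real.log (pnorm ν 2 g / pnorm ν 1 g)) * t)) := by
        rw [mul_right_comm (Real.exp _), ← Real.exp_add, mul_comm (pnorm ν 2 g ^ 2)]
        congr 2
        ring
      _ ≤ _ := by gcongr
  refine (intervalIntegral.integral_mono_on hT0 ((hcont.pow 2).intervalIntegrable _ _)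
    (Continuous.intervalIntegrable (by fun_prop) _ _) hbound).trans ?_
  rw [intervalIntegral.integral_const_mul]
  exact (mul_le_mul_of_nonneg_left (integral_exp_neg_mul_le (by positivity) T)
    (by positivity)).trans_eq (mul_one_div _ _)
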